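/- arXiv:2205.00588 — 2 statements merged into one kernel-verified Lean document; each statement's English description precedes it below -/
import Mathlib

section
/- Fix integers k ≥ 1 and n ≥ 1. For τ ∈ (0,1], let (x(τ), y(τ)) be the unique element of P(k,n) with y_i^l(τ) = τ·x_i^l(τ) for all i ∈ {1,...,n}, l ∈ {1,...,k}. Given reals τ̲ and τ̄ with 0 < τ̲ < τ̄ ≤ 1, there exists τ ∈ [τ̲, τ̄] such that for every q ∈ (0,1]: Σ_{i=1}^n Σ_{l=1}^k min{y_i^l(τ), q·x_i^l(τ)} ≥ (1/2)·( Σ_{i=1}^n Σ_{l=1}^k min{y_i^l(τ̲), q·x_i^l(τ̲)} + Σ_{i=1}^n Σ_{l=1}^k min{y_i^l(τ̄), q·x_i^l(τ̄)} ). -/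
open Finset

/-- The polytope `P(k,n)` of state/acceptance probability vectors. -/
def memP (k n : ℕ) (x y : ℕ → ℕ → ℝ) : Prop :=
  x 1 k = 1 ∧
  (∀ l, 1 ≤ l → l < k → x 1 l = 0) ∧
  (∀ i ∈ Finset.Icc 2 n, ∀ l ∈ Finset.Icc 1 k,
    x i l = x (i-1) l - y (i-1) l + (if l < k then y (i-1) (l+1) else 0)) ∧
  (∀ i ∈ Finset.Icc 1 n, ∀ l ∈ Finset.Icc 1 k, 0 ≤ y i l ∧ y i l ≤ x i l)

/-- Binomial probabilities. -/
noncomputable def bb (n j : ℕ) (t : ℝ) : ℝ := (n.choose j : ℝ) * t ^ j * (1 - t) ^ (n - j)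

lemma bb_nonneg (n j : ℕ) (t : ℝ) (h0 : 0 ≤ t) (h1 : t ≤ 1) : 0 ≤ bb n j t := by
  have : 0 ≤ 1 - t := by linarith
  unfold bb; positivity

lemma bb_zero_of_lt {n j : ℕ} (h : n < j) (t : ℝ) : bb n j t = 0 := by
  simp [bb, Nat.choose_eq_zero_of_lt h]

lemma bb_succ_zero (n : ℕ) (t : ℝ) : bb (n+1) 0 t = (1 - t) * bb n 0 t := by
  simp [bb, pow_succ]; ring

lemma bb_succ_succ (n j : ℕ) (t : ℝ) :
    bb (n+1) (j+1) t = (1 - t) * bb n (j+1) t + t * bb n j t := by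
  rcases lt_or_ge n (j+1) with h | h
  · rw [bb_zero_of_lt h]
    simp only [bb, Nat.choose_succ_succ, Nat.choose_eq_zero_of_lt h, Nat.add_sub_add_right]
    push_cast; ring
  · obtain ⟨d, rfl⟩ := Nat.exists_eq_add_of_le h
    have e1 : j + 1 + d + 1 - (j + 1) = d + 1 := by omega
    have e2 : j + 1 + d - (j + 1) = d := by omega
    have e3 : j + 1 + d - j = d + 1 := by omega
    simp only [bb, Nat.choose_succ_succ (j+1+d) j, e1, e2, e3]
    push_cast; ring

/-- ratio identity -/
lemma bb_ratio (n j : ℕ) (t : ℝ) :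
    (1 - t) * (((j:ℝ) + 1) * bb n (j+1) t) = t * (((n:ℝ) - j) * bb n j t) := by
  rcases lt_trichotomy n j with h | h | h
  · rw [bb_zero_of_lt h, bb_zero_of_lt (by omega : n < j+1)]; ring
  · subst h
    rw [bb_zero_of_lt (by omega : n < n+1)]; ring
  · obtain ⟨d, rfl⟩ := Nat.exists_eq_add_of_lt h
    have e2 : j + d + 1 - (j + 1) = d := by omega
    have e3 : j + d + 1 - j = d + 1 := by omega
    have := Nat.choose_succ_right_eq (j+d+1) j
    rw [e3] at this
    have h' : (((j+d+1).choose (j+1) : ℕ) : ℝ) * (j+1) = ((j+d+1).choose j : ℕ) * (d+1) := by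
      exact_mod_cast this
    simp only [bb, e2, e3]
    push_cast
    linear_combination (1-t)^(d+1) * t^(j+1) * h'

lemma bb_absorb (n j : ℕ) (t : ℝ) :
    ((j:ℝ) + 1) * bb (n+1) (j+1) t = ((n:ℝ)+1) * t * bb n j t := by
  have := Nat.add_one_mul_choose_eq n j
  have h' : ((n:ℝ)+1) * (n.choose j : ℕ) = ((n+1).choose (j+1) : ℕ) * ((j:ℝ)+1) := by
    exact_mod_cast this
  simp only [bb, Nat.add_sub_add_right]
  linear_combination -(t^(j+1) * (1-t)^(n-j)) * h'

lemma bb_key (n i j : ℕ) (hij : i ≤ j) (t : ℝ) (h0 : 0 ≤ t) (h1 : t < 1) :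
    ((j:ℝ)+1) * bb n (j+1) t * (i * bb n i t)
      ≤ i * (((i:ℝ)+1) * bb n (i+1) t) * bb n j t := by
  have hw : 0 < 1 - t := by linarith
  refine le_of_mul_le_mul_left ?_ hw
  have e1 := bb_ratio n j t
  have e2 := bb_ratio n i t
  have hp : 0 ≤ t * i * bb n i t * bb n j t := by
    have := bb_nonneg n i t h0 h1.le
    have := bb_nonneg n j t h0 h1.le
    positivity
  have hc : (i:ℝ) ≤ j := by exact_mod_cast hij
  nlinarith [mul_le_mul_of_nonneg_left hc hp, congrArg (· * (i * bb n i t)) e1,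
    congrArg (· * (i * bb n j t)) e2]

/-- partial sums `∑_{i ≤ I} i b_i` -/
noncomputable def CC (n I : ℕ) (t : ℝ) : ℝ := ∑ i ∈ range (I+1), (i:ℝ) * bb n i t
/-- upper tail -/
noncomputable def BB (n J : ℕ) (t : ℝ) : ℝ := ∑ j ∈ Ico J (n+1), bb n j t
/-- upper tail mean -/
noncomputable def EE (n J : ℕ) (t : ℝ) : ℝ := ∑ j ∈ Ico J (n+1), (j:ℝ) * bb n j t

lemma CC_succ (n I : ℕ) (t : ℝ) :
    CC n (I+1) t = CC n I t + ((I:ℝ)+1) * bb n (I+1) t := by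
  unfold CC; rw [sum_range_succ _ (I+1)]; push_cast; rfl

lemma BB_rec (n J : ℕ) (t : ℝ) : BB n J t = bb n J t + BB n (J+1) t := by
  unfold BB
  rcases lt_or_ge J (n+1) with h | h
  · rw [sum_eq_sum_Ico_succ_bot h]
  · rw [Ico_eq_empty (by omega), Ico_eq_empty (by omega), bb_zero_of_lt (by omega)]; simp

lemma CC_nonneg (n I : ℕ) (t : ℝ) (h0 : 0 ≤ t) (h1 : t ≤ 1) : 0 ≤ CC n I t :=
  sum_nonneg fun i _ => mul_nonneg (Nat.cast_nonneg _) (bb_nonneg _ _ _ h0 h1)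

lemma BB_nonneg (n I : ℕ) (t : ℝ) (h0 : 0 ≤ t) (h1 : t ≤ 1) : 0 ≤ BB n I t :=
  sum_nonneg fun i _ => (bb_nonneg _ _ _ h0 h1)

lemma BB_le_EE (n J : ℕ) (t : ℝ) (h0 : 0 ≤ t) (h1 : t ≤ 1) : (J:ℝ) * BB n J t ≤ EE n J t := by
  unfold BB EE
  rw [mul_sum]
  refine sum_le_sum fun j hj => ?_
  have : (J:ℝ) ≤ j := by exact_mod_cast (mem_Ico.1 hj).1
  exact mul_le_mul_of_nonneg_right this (bb_nonneg _ _ _ h0 h1)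

lemma EE_le (n i J : ℕ) (hij : i ≤ J) (t : ℝ) (h0 : 0 ≤ t) (h1 : t < 1) :
    (i * bb n i t) * EE n (J+1) t ≤ i * (((i:ℝ)+1) * bb n (i+1) t) * BB n J t := by
  have h : EE n (J+1) t = ∑ j ∈ Ico J n, ((j:ℝ)+1) * bb n (j+1) t := by
    unfold EE
    rw [← sum_Ico_add' (fun j : ℕ => (j:ℝ) * bb n j t) J n 1]
    push_cast; rfl
  have h2 : ∑ j ∈ Ico J n, bb n j t ≤ BB n J t := by
    unfold BB
    exact sum_le_sum_of_subset_of_nonneg (Ico_subset_Ico le_rfl (by omega))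
      fun i _ _ => bb_nonneg _ _ _ h0 h1.le
  have h3 : 0 ≤ i * (((i:ℝ)+1) * bb n (i+1) t) := by
    have := bb_nonneg n (i+1) t h0 h1.le
    positivity
  refine le_trans ?_ (mul_le_mul_of_nonneg_left h2 h3)
  rw [h, mul_sum, mul_sum]
  refine sum_le_sum fun j hj => ?_
  have := bb_key n i j (hij.trans (mem_Ico.1 hj).1) t h0 h1
  linarith

lemma CC_le (n I J : ℕ) (hij : I ≤ J) (t : ℝ) (h0 : 0 ≤ t) (h1 : t < 1) :
    ((J:ℝ)+1) * bb n (J+1) t * CC n I t ≤ I * bb n J t * CC n (I+1) t := by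
  have h : CC n (I+1) t = ∑ i ∈ range (I+1), ((i:ℝ)+1) * bb n (i+1) t := by
    unfold CC
    rw [sum_range_succ']; push_cast; simp
  rw [h]; unfold CC
  rw [mul_sum, mul_sum]
  refine sum_le_sum fun i hi => ?_
  have hi' : i ≤ I := by have := mem_range.1 hi; omega
  refine (bb_key n i J (hi'.trans hij) t h0 h1).trans ?_
  have hc : (i:ℝ) ≤ I := by exact_mod_cast hi'
  have := bb_nonneg n (i+1) t h0 h1.le
  have := bb_nonneg n J t h0 h1.le
  have hp : 0 ≤ (((i:ℝ)+1) * bb n (i+1) t) * bb n J t := by positivity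
  nlinarith [mul_le_mul_of_nonneg_right hc hp]

lemma hook (n : ℕ) (t : ℝ) (h0 : 0 ≤ t) (h1 : t < 1) (I : ℕ) : ∀ J, I < J →
    2 * CC n I t * BB n J t ≤ J * bb n J t * CC n I t + (I * bb n I t) * EE n (J+1) t := by
  induction I with
  | zero => intro J _; simp [CC]
  | succ I ih =>
    intro J hJ
    have a := ih (J+1) (by omega)
    have b := CC_le n I J (by omega) t h0 h1
    have c := EE_le n I (J+1) (by omega) t h0 h1
    have d := BB_le_EE n (J+1) t h0 h1.le
    have e := CC_succ n I t
    have f := BB_rec n J t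
    have p1 := bb_nonneg n J t h0 h1.le
    have p2 := bb_nonneg n (I+1) t h0 h1.le
    have p3 := CC_nonneg n (I+1) t h0 h1.le
    have p4 := BB_nonneg n (J+1) t h0 h1.le
    have hc : (I:ℝ) + 2 ≤ J := by exact_mod_cast hJ
    push_cast at *
    set c1 := ((I:ℝ)+1) * bb n (I+1) t with hc1
    have pc1 : 0 ≤ c1 := by positivity
    have q1 : ((I:ℝ)+2) * (bb n J t * CC n (I+1) t) ≤ J * (bb n J t * CC n (I+1) t) :=
      mul_le_mul_of_nonneg_right hc (by positivity)
    have q2 : c1 * (((J:ℝ)+1) * BB n (J+1) t) ≤ c1 * EE n (J+1) t :=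
      mul_le_mul_of_nonneg_left d pc1
    have q3 : ((I:ℝ)+2) * (c1 * BB n (J+1) t) ≤ (J+1) * (c1 * BB n (J+1) t) :=
      mul_le_mul_of_nonneg_right (by linarith) (by positivity)
    have q4 : 2 * CC n (I+1) t * BB n J t = 2 * CC n (I+1) t * bb n J t
        + 2 * c1 * BB n (J+1) t + 2 * CC n I t * BB n (J+1) t := by
      rw [f, e]; ring
    rw [q4]
    linarith

lemma main_ineq (n k : ℕ) (t : ℝ) (h0 : 0 ≤ t) (h1 : t < 1) :
    2 * CC n k t * BB n (k+1) t ≤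
      (((k:ℝ)+1) * bb n (k+1) t) * (CC n k t + k * BB n (k+1) t) := by
  have a := hook n t h0 h1 k (k+1) (by omega)
  have c := EE_le n k (k+1) (by omega) t h0 h1
  push_cast at *
  linarith

lemma hasDerivAt_bb (n j : ℕ) (t : ℝ) :
    HasDerivAt (bb (n+1) (j+1)) (((n:ℝ)+1) * (bb n j t - bb n (j+1) t)) t := by
  have e : ∀ n j, ∀ t : ℝ, bb n j t = (bernsteinPolynomial ℝ n j).eval t := by
    intro n j t; simp [bb, bernsteinPolynomial]
  have := (bernsteinPolynomial ℝ (n+1) (j+1)).hasDerivAt t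
  rw [bernsteinPolynomial.derivative_succ] at this
  rw [show bb (n+1) (j+1) = fun t => (bernsteinPolynomial ℝ (n+1) (j+1)).eval t from
    funext (e _ _)]
  refine this.congr_deriv ?_
  simp [e]

lemma BB_zero (n : ℕ) (t : ℝ) : BB n 0 t = 1 := by
  have := congrArg (Polynomial.eval t) (bernsteinPolynomial.sum ℝ n)
  rw [Polynomial.eval_finsetSum] at this
  simp only [Polynomial.eval_one] at this
  rw [← this]
  unfold BB
  rw [Nat.Ico_zero_eq_range]
  refine sum_congr rfl fun j _ => ?_
  simp [bb, bernsteinPolynomial]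

lemma hasDerivAt_BB (n j : ℕ) (t : ℝ) :
    HasDerivAt (BB (n+1) (j+1)) (((n:ℝ)+1) * bb n j t) t := by
  induction j with
  | zero =>
    have h : BB (n+1) (0+1) = fun t => 1 - (1-t)^(n+1) := by
      funext s
      have := BB_rec (n+1) 0 s
      rw [BB_zero] at this
      simp [bb] at this ⊢
      linarith
    rw [h]
    have h2 := (((hasDerivAt_id t).const_sub 1).pow (n+1)).const_sub 1
    refine h2.congr_deriv ?_
    simp [bb]
  | succ j ih =>
    have h : BB (n+1) (j+1+1) = BB (n+1) (j+1) - bb (n+1) (j+1) := by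
      funext s
      have := BB_rec (n+1) (j+1) s
      simp only [Pi.sub_apply]; linarith
    rw [h]
    refine (ih.sub (hasDerivAt_bb n j t)).congr_deriv ?_
    ring

/-- Total number of visited states. -/
noncomputable def SS (n k : ℕ) (t : ℝ) : ℝ := ∑ i ∈ range n, ∑ j ∈ range k, bb i j t

lemma BB_step (n j : ℕ) (t : ℝ) : BB (n+1) (j+1) t = BB n (j+1) t + t * bb n j t := by
  induction j with
  | zero =>
    have a := BB_rec (n+1) 0 t
    have b := BB_rec n 0 t
    rw [BB_zero] at a b
    have c := bb_succ_zero n t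
    simp only [zero_add] at *
    linarith
  | succ j ih =>
    have a := BB_rec (n+1) (j+1) t
    have b := BB_rec n (j+1) t
    have c := bb_succ_succ n j t
    linarith

lemma t_mul_SS (n k : ℕ) (t : ℝ) : t * SS n k t = ∑ j ∈ range k, BB n (j+1) t := by
  induction n with
  | zero => simp [SS, BB]
  | succ n ih =>
    have : SS (n+1) k t = SS n k t + ∑ j ∈ range k, bb n j t := by
      unfold SS; rw [sum_range_succ]
    rw [this, mul_add, ih, mul_sum, ← sum_add_distrib]
    exact sum_congr rfl fun j _ => (BB_step n j t).symm

lemma A_eq (n k : ℕ) (t : ℝ) :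
    ∑ j ∈ range k, BB n (j+1) t = CC n k t + k * BB n (k+1) t := by
  induction k with
  | zero => simp [CC]
  | succ k ih =>
    rw [sum_range_succ, ih, CC_succ, BB_rec n (k+1)]; push_cast; ring

lemma one_le_SS (n k : ℕ) (hk : 1 ≤ k) (hn : 1 ≤ n) (t : ℝ) (h0 : 0 ≤ t) (h1 : t ≤ 1) :
    1 ≤ SS n k t := by
  have e : (1:ℝ) = bb 0 0 t := by simp [bb]
  rw [e]
  unfold SS
  refine le_trans ?_ (single_le_sum (f := fun i => ∑ j ∈ range k, bb i j t)
    (fun i _ => sum_nonneg fun j _ => bb_nonneg i j t h0 h1) (mem_range.2 (by omega : 0 < n)))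
  exact single_le_sum (f := fun j => bb 0 j t)
    (fun j _ => bb_nonneg 0 j t h0 h1) (mem_range.2 (by omega : 0 < k))

lemma convex_inv (n k : ℕ) (hk : 1 ≤ k) (a b : ℝ) (h0 : 0 < a) (h1 : b ≤ 1) :
    ConvexOn ℝ (Set.Icc a b) (fun t => t / ((t * SS (n+1) k t))) := by
  have hA : ∀ t ∈ Set.Icc a b, 0 < t * SS (n+1) k t := fun t ht => by
    have := one_le_SS (n+1) k hk (by omega) t (by linarith [ht.1]) (ht.2.trans h1)
    have := ht.1
    have : 0 < t := by linarith
    positivity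
  have hAd : ∀ t, 0 < t → HasDerivAt (fun t => t * SS (n+1) k t) (CC (n+1) k t / t) t := by
    intro t ht
    have h := HasDerivAt.fun_sum (u := range k) (fun j _ => hasDerivAt_BB n j t)
    rw [show (fun t => t * SS (n+1) k t) = fun t => ∑ j ∈ range k, BB (n+1) (j+1) t from
      funext (t_mul_SS _ _)]
    refine h.congr_deriv ?_
    rw [eq_div_iff ht.ne', sum_mul]
    unfold CC
    rw [sum_range_succ']
    simp only [Nat.cast_zero, zero_mul, add_zero]
    refine sum_congr rfl fun j _ => ?_
    have := bb_absorb n j t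
    push_cast
    linarith
  have hAe : ∀ t, t * SS (n+1) k t = CC (n+1) k t + k * BB (n+1) (k+1) t := fun t => by
    rw [t_mul_SS, A_eq]
  have hg : ∀ t ∈ Set.Icc a b, HasDerivAt (fun t => t / ((t * SS (n+1) k t)))
      (k * BB (n+1) (k+1) t / (t * SS (n+1) k t)^2) t := by
    intro t ht
    have ht0 : 0 < t := h0.trans_le ht.1
    have := (hasDerivAt_id' t).fun_div (hAd t ht0) (hA t ht).ne'
    refine this.congr_deriv ?_
    congr 1
    have := hAe t
    field_simp
    linarith
  have hI : interior (Set.Icc a b) ⊆ Set.Icc a b := interior_subset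
  refine convexOn_of_hasDerivWithinAt2_nonneg (convex_Icc a b)
    (f' := fun t => k * BB (n+1) (k+1) t / (t * SS (n+1) k t)^2)
    (f'' := fun t => ((k * (((n:ℝ)+1) * bb n k t)) * (t * SS (n+1) k t)^2 -
      (k * BB (n+1) (k+1) t) * (2 * (t * SS (n+1) k t) * (CC (n+1) k t / t)))
        / ((t * SS (n+1) k t)^2)^2)
    (fun t ht => (hg t ht).continuousAt.continuousWithinAt)
    (fun t ht => (hg t (hI ht)).hasDerivWithinAt) ?_ ?_
  · intro t ht
    have ht' := hI ht
    have ht0 : 0 < t := h0.trans_le ht'.1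
    have hp := hA t ht'
    have := ((hasDerivAt_BB n k t).const_mul (k:ℝ)).fun_div ((hAd t ht0).fun_pow 2)
      (pow_pos hp 2).ne'
    refine HasDerivAt.hasDerivWithinAt ?_
    refine this.congr_deriv ?_
    simp
  · intro t ht
    have ht' := hI ht
    rw [interior_Icc] at ht
    have ht0 : 0 < t := h0.trans_le ht'.1
    have hp := hA t ht'
    have key := main_ineq (n+1) k t ht0.le (ht.2.trans_le h1)
    rw [← hAe, bb_absorb] at key
    apply div_nonneg _ (by positivity)
    set A := t * SS (n+1) k t
    have e : (k * (((n:ℝ)+1) * bb n k t)) * A^2 -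
      (k * BB (n+1) (k+1) t) * (2 * A * (CC (n+1) k t / t))
      = k * A / t * ((((n:ℝ)+1) * t * bb n k t) * A - 2 * CC (n+1) k t * BB (n+1) (k+1) t) := by
      field_simp
    rw [e]
    exact mul_nonneg (by positivity) (by linarith)

lemma x_eq (k n : ℕ) (x y : ℕ → ℕ → ℝ) (t : ℝ) (h : memP k n x y)
    (hy : ∀ i ∈ Finset.Icc 1 n, ∀ l ∈ Finset.Icc 1 k, y i l = t * x i l) (i : ℕ) :
    i < n → ∀ j < k, x (i+1) (k-j) = bb i j t := by
  obtain ⟨ha, hb, hc, -⟩ := h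
  induction i with
  | zero =>
    intro _ j hj
    rcases j with _ | j
    · simpa [bb] using ha
    · rw [hb _ (by omega) (by omega), bb_zero_of_lt (by omega)]
  | succ i ih =>
    intro hi j hj
    have ih' := ih (by omega)
    rw [hc (i+1+1) (mem_Icc.2 ⟨by omega, by omega⟩) (k-j) (mem_Icc.2 ⟨by omega, by omega⟩)]
    simp only [Nat.add_sub_cancel]
    rw [hy (i+1) (mem_Icc.2 ⟨by omega, by omega⟩) (k-j) (mem_Icc.2 ⟨by omega, by omega⟩),
      ih' j hj]
    rcases j with _ | j
    · rw [bb_succ_zero]; simp; ring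
    · rw [if_pos (by omega), show k - (j+1) + 1 = k - j by omega,
        hy (i+1) (mem_Icc.2 ⟨by omega, by omega⟩) (k-j) (mem_Icc.2 ⟨by omega, by omega⟩),
        ih' j (by omega), bb_succ_succ]
      ring

lemma sum_eq (k n : ℕ) (x y : ℕ → ℕ → ℝ) (t : ℝ) (h0 : 0 ≤ t) (h1 : t ≤ 1) (h : memP k n x y)
    (hy : ∀ i ∈ Finset.Icc 1 n, ∀ l ∈ Finset.Icc 1 k, y i l = t * x i l) (q : ℝ) :
    ∑ i ∈ Finset.Icc 1 n, ∑ l ∈ Finset.Icc 1 k, min (y i l) (q * x i l)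
      = min t q * SS n k t := by
  have e : ∀ (m : ℕ) (f : ℕ → ℝ), ∑ i ∈ Finset.Icc 1 m, f i = ∑ i ∈ range m, f (i+1) := by
    intro m f
    rw [range_eq_Ico, sum_Ico_add' f 0 m 1]
    rfl
  unfold SS
  rw [e, mul_sum]
  refine sum_congr rfl fun i hi => ?_
  have hi' := mem_range.1 hi
  rw [e, ← sum_range_reflect, mul_sum]
  refine sum_congr rfl fun j hj => ?_
  have hj' := mem_range.1 hj
  rw [show k - 1 - j + 1 = k - j by omega,
    hy (i+1) (mem_Icc.2 ⟨by omega, by omega⟩) (k-j) (mem_Icc.2 ⟨by omega, by omega⟩),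
    x_eq k n x y t h hy i hi' j hj', min_mul_of_nonneg _ _ (bb_nonneg i j t h0 h1)]

lemma exists_tau (k n : ℕ) (hk : 1 ≤ k) (hn : 1 ≤ n)
    (a b : ℝ) (h0 : 0 < a) (hlth : a < b) (hhi : b ≤ 1) :
    ∃ t ∈ Set.Icc a b, SS n k a + SS n k b ≤ 2 * SS n k t ∧
      a * SS n k a + b * SS n k b ≤ 2 * (t * SS n k t) := by
  obtain ⟨m, rfl⟩ : ∃ m, n = m + 1 := ⟨n - 1, by omega⟩
  have pa := one_le_SS (m+1) k hk hn a h0.le (by linarith)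
  have pb := one_le_SS (m+1) k hk hn b (by linarith) hhi
  have hcv := convex_inv m k hk a b h0 hhi
  set A := SS (m+1) k a with hA
  set B := SS (m+1) k b with hB
  have hs : 0 < A + B := by linarith
  have hc := hcv.2 (Set.left_mem_Icc.2 hlth.le) (Set.right_mem_Icc.2 hlth.le)
    (show 0 ≤ A/(A+B) by positivity) (show 0 ≤ B/(A+B) by positivity) (by field_simp)
  have ht := hcv.1 (Set.left_mem_Icc.2 hlth.le) (Set.right_mem_Icc.2 hlth.le)
    (show 0 ≤ A/(A+B) by positivity) (show 0 ≤ B/(A+B) by positivity) (by field_simp)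
  simp only [smul_eq_mul] at hc ht
  set t := A/(A+B) * a + B/(A+B) * b with htd
  have pt := one_le_SS (m+1) k hk hn t (by linarith [ht.1]) (by linarith [ht.2])
  have t0 : 0 < t := by linarith [ht.1]
  have b0 : 0 < b := by linarith
  rw [← hA, ← hB] at hc
  set T := SS (m+1) k t with hT
  have e1 : t / (t * T) = 1 / T := by field_simp
  have e2 : A / (A+B) * (a / (a * A)) + B / (A+B) * (b / (b * B)) = 2 / (A+B) := by
    field_simp; norm_num
  rw [e1, e2, div_le_div_iff₀ (by linarith) hs] at hc
  have e3 : t * (A + B) = a * A + b * B := by rw [htd]; field_simp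
  refine ⟨t, ht, by linarith, ?_⟩
  nlinarith

/-- Theorem `iidSTNoBetter`: given `0 < τ̲ < τ̄ ≤ 1`, there exists
`τ ∈ [τ̲, τ̄]` such that for the (unique) static threshold solutions
`(x(τ),y(τ)), (x(τ̲),y(τ̲)), (x(τ̄),y(τ̄)) ∈ P(k,n)` and every `q ∈ (0,1]`,
`Σ_{i,l} min{y_i^l(τ), q·x_i^l(τ)} ≥
 (1/2)·(Σ_{i,l} min{y_i^l(τ̲), q·x_i^l(τ̲)} + Σ_{i,l} min{y_i^l(τ̄), q·x_i^l(τ̄)})`. -/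
theorem stmt15 (k n : ℕ) (hk : 1 ≤ k) (hn : 1 ≤ n)
    (τlo τhi : ℝ) (h0 : 0 < τlo) (hlth : τlo < τhi) (hhi : τhi ≤ 1) :
    ∃ τ ∈ Set.Icc τlo τhi,
      ∀ x y xlo ylo xhi yhi : ℕ → ℕ → ℝ,
        memP k n x y →
        (∀ i ∈ Finset.Icc 1 n, ∀ l ∈ Finset.Icc 1 k, y i l = τ * x i l) →
        memP k n xlo ylo →
        (∀ i ∈ Finset.Icc 1 n, ∀ l ∈ Finset.Icc 1 k, ylo i l = τlo * xlo i l) →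
        memP k n xhi yhi →
        (∀ i ∈ Finset.Icc 1 n, ∀ l ∈ Finset.Icc 1 k, yhi i l = τhi * xhi i l) →
        ∀ q ∈ Set.Ioc (0:ℝ) 1,
          (∑ i ∈ Finset.Icc 1 n, ∑ l ∈ Finset.Icc 1 k, min (y i l) (q * x i l))
            ≥ (1/2) *
              ((∑ i ∈ Finset.Icc 1 n, ∑ l ∈ Finset.Icc 1 k, min (ylo i l) (q * xlo i l))
               + ∑ i ∈ Finset.Icc 1 n, ∑ l ∈ Finset.Icc 1 k, min (yhi i l) (q * xhi i l)) := by
  obtain ⟨t, ht, hS, hA⟩ := exists_tau k n hk hn τlo τhi h0 hlth hhi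
  refine ⟨t, ht, ?_⟩
  intro x y xlo ylo xhi yhi h hy hlo hylo hhi' hyhi q hq
  have t0 : 0 < t := h0.trans_le ht.1
  rw [sum_eq k n x y t t0.le (ht.2.trans hhi) h hy,
    sum_eq k n xlo ylo τlo h0.le (by linarith) hlo hylo,
    sum_eq k n xhi yhi τhi (by linarith) hhi hhi' hyhi]
  have pa := one_le_SS n k hk hn τlo h0.le (by linarith)
  have pb := one_le_SS n k hk hn τhi (by linarith) hhi
  have q0 := hq.1
  rcases le_total t q with h1 | h1
  · rw [min_eq_left h1]
    have u1 : min τlo q * SS n k τlo ≤ τlo * SS n k τlo :=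
      mul_le_mul_of_nonneg_right (min_le_left _ _) (by linarith)
    have u2 : min τhi q * SS n k τhi ≤ τhi * SS n k τhi :=
      mul_le_mul_of_nonneg_right (min_le_left _ _) (by linarith)
    linarith
  · rw [min_eq_right h1]
    have u1 : min τlo q * SS n k τlo ≤ q * SS n k τlo :=
      mul_le_mul_of_nonneg_right (min_le_right _ _) (by linarith)
    have u2 : min τhi q * SS n k τhi ≤ q * SS n k τhi :=
      mul_le_mul_of_nonneg_right (min_le_right _ _) (by linarith)
    have u3 := mul_le_mul_of_nonneg_left hS q0.le
    linarith
end

section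
/- Suppose θ* ∈ (0,1) and H: [0,1] → [0,1] is a continuous function with H(0) = 1, H(1) = 0, H(x) > 0 for all x ∈ (0,1), H differentiable on (0,1), and 1/θ* - 1 = H(x)·(ln H(x) - 1) - H'(x) for all x ∈ (0,1). Then inf_{n≥2} iidLP^{DP/Proph}_{1,n} = lim_{n→∞} iidLP^{DP/Proph}_{1,n} = θ*. -/
open Finset

/-- `iidLP^{DP/Proph}_{1,n}` in its single-unit form. -/
noncomputable def iidLP1 (n : ℕ) : ℝ :=
  sSup {θ : ℝ | ∃ y : ℕ → ℝ,
    (∀ i ∈ Finset.Icc 1 n, 0 ≤ y i) ∧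
    (∑ i ∈ Finset.Icc 1 n, y i ≤ 1) ∧
    ∀ κ ∈ Set.Ioc (0:ℝ) 1,
      (1 - (1 - κ) ^ n) * θ ≤
        ∑ i ∈ Finset.Icc 1 n, min (y i) (κ * (1 - ∑ i' ∈ Finset.Icc 1 (i-1), y i'))}

lemma sum_Icc_one' (f : ℕ → ℝ) (n : ℕ) :
    ∑ i ∈ Finset.Icc 1 n, f i = ∑ i ∈ Finset.range n, f (i+1) := by
  induction n with
  | zero => simp
  | succ k ih => rw [Finset.sum_Icc_succ_top (by omega), ih, Finset.sum_range_succ]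

/-- A barrier lemma. -/
lemma barrier (D D' : ℝ → ℝ) (h : ℝ) (hh : 0 ≤ h) (hc : ContinuousOn D (Set.Icc 0 h))
    (h0 : D 0 ≤ 0)
    (hd : ∀ s ∈ Set.Ioo 0 h, 0 < D s → HasDerivAt D (D' s) s ∧ D' s ≤ 0) : D h ≤ 0 := by
  by_contra hcon
  push Not at hcon
  set S := Set.Icc 0 h ∩ D ⁻¹' (Set.Iic 0) with hS
  have hclosed : IsClosed S := hc.preimage_isClosed_of_isClosed isClosed_Icc isClosed_Iic
  have hne : S.Nonempty := ⟨0, ⟨le_refl _, hh⟩, h0⟩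
  have hbdd : BddAbove S := ⟨h, fun x hx => hx.1.2⟩
  have hmem : sSup S ∈ S := hclosed.csSup_mem hne hbdd
  set s0 := sSup S
  have hpos : ∀ s ∈ Set.Ioo s0 h, 0 < D s := by
    intro s hs
    by_contra hcc
    push Not at hcc
    have : s ∈ S := ⟨⟨hmem.1.1.trans hs.1.le, hs.2.le⟩, hcc⟩
    exact absurd (le_csSup hbdd this) (not_le.mpr hs.1)
  have hsub : Set.Icc s0 h ⊆ Set.Icc 0 h := Set.Icc_subset_Icc_left hmem.1.1
  have hder : ∀ s ∈ Set.Ioo s0 h, HasDerivAt D (D' s) s ∧ D' s ≤ 0 := fun s hs =>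
    hd s ⟨lt_of_le_of_lt hmem.1.1 hs.1, hs.2⟩ (hpos s hs)
  have hanti : AntitoneOn D (Set.Icc s0 h) := by
    apply antitoneOn_of_deriv_nonpos (convex_Icc _ _) (hc.mono hsub)
    · rw [interior_Icc]
      intro s hs
      exact (hder s hs).1.differentiableAt.differentiableWithinAt
    · rw [interior_Icc]
      intro s hs
      rw [(hder s hs).1.deriv]
      exact (hder s hs).2
  have := hanti ⟨le_refl _, hmem.1.2⟩ ⟨hmem.1.2, le_refl _⟩ hmem.1.2
  have h2 : D s0 ≤ 0 := hmem.2
  linarith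

lemma F_anti (a p : ℝ) (ha : 0 < a) (hap : a ≤ p) (hp : p ≤ 1) :
    p * (Real.log p - 1) ≤ a * (Real.log a - 1) := by
  have hp0 : 0 < p := ha.trans_le hap
  have h1 : Real.log (p / a) ≤ p / a - 1 := Real.log_le_sub_one_of_pos (by positivity)
  rw [Real.log_div hp0.ne' ha.ne'] at h1
  have h2 : a * (Real.log p - Real.log a) ≤ p - a := by
    have := mul_le_mul_of_nonneg_left h1 ha.le
    have e : a * (p / a - 1) = p - a := by field_simp
    linarith
  have h3 : Real.log p ≤ 0 := Real.log_nonpos hp0.le hp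
  nlinarith [mul_nonneg (sub_nonneg.mpr hap) (neg_nonneg.mpr h3)]

/-- One Euler-type step stays below the solution. -/
lemma step (c : ℝ) (hc : 0 < c) (H H' : ℝ → ℝ)
    (hmaps : ∀ x ∈ Set.Icc (0:ℝ) 1, H x ∈ Set.Icc (0:ℝ) 1)
    (hcont : ContinuousOn H (Set.Icc (0:ℝ) 1))
    (hpos : ∀ x ∈ Set.Ioo (0:ℝ) 1, 0 < H x)
    (hderiv : ∀ x ∈ Set.Ioo (0:ℝ) 1, HasDerivAt H (H' x) x)
    (hode : ∀ x ∈ Set.Ioo (0:ℝ) 1, c = H x * (Real.log (H x) - 1) - H' x)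
    (x h : ℝ) (hx : 0 ≤ x) (hh : 0 < h) (hh1 : h < 1) (hxh : x + h ≤ 1) (hHx : 0 < H x) :
    (1 - h) * Real.exp (Real.log (H x) / (1 - h)) - h * c ≤ H (x + h) := by
  set L := Real.log (H x) with hL
  have hL0 : L ≤ 0 := Real.log_nonpos hHx.le (hmaps x ⟨hx, by linarith⟩).2
  have key := barrier (fun s => (1 - s) * Real.exp (L / (1 - s)) - s * c - H (x + s))
    (fun s => Real.exp (L / (1 - s)) * (L / (1 - s) - 1) - c - H' (x + s)) h hh.le ?_ ?_ ?_
  · linarith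
  · apply ContinuousOn.sub
    · apply ContinuousOn.sub
      · apply ContinuousOn.mul (by fun_prop)
        apply Real.continuous_exp.comp_continuousOn
        apply ContinuousOn.div (by fun_prop) (by fun_prop)
        intro s hs
        have := hs.2
        linarith
      · fun_prop
    · apply hcont.comp (by fun_prop)
      intro s hs
      exact ⟨by linarith [hs.1], by linarith [hs.2]⟩
  · simp [hL, Real.exp_log hHx]
  · intro s hs hD
    have hs1 : 0 < 1 - s := by linarith [hs.2]
    have hxs : x + s ∈ Set.Ioo (0:ℝ) 1 := ⟨by linarith [hs.1], by linarith [hs.2]⟩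
    constructor
    · have d1 : HasDerivAt (fun s : ℝ => 1 - s) (-1) s := by
        simpa using (hasDerivAt_id s).const_sub 1
      have d2 := ((hasDerivAt_const s L).div d1 hs1.ne').exp
      have d3 := (d1.mul d2).sub ((hasDerivAt_id s).mul_const c)
      have d4 : HasDerivAt (fun s => H (x + s)) (H' (x + s)) s := by
        exact (hderiv _ hxs).comp_const_add x s
      refine (d3.sub d4).congr_deriv ?_
      simp
      field_simp
      ring
    · set p := Real.exp (L / (1 - s)) with hp
      have hlogp : Real.log p = L / (1 - s) := by rw [hp, Real.log_exp]
      have hp0 : 0 < p := Real.exp_pos _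
      have hp1 : p ≤ 1 := Real.exp_le_one_iff.mpr (div_nonpos_of_nonpos_of_nonneg hL0 hs1.le)
      have hle : H (x + s) ≤ p := by nlinarith [mul_pos hs.1 hp0, mul_pos hs.1 hc]
      have := F_anti _ p (hpos _ hxs) hle hp1
      have := hode _ hxs
      rw [← hlogp]
      linarith

lemma B_deriv (k : ℕ) (a v : ℝ) :
    HasDerivAt (fun v : ℝ => 1 - (k+2) * a * v^(k+1) + (k+1) * v^(k+2))
      ((k+2)*(k+1)*v^k*(v-a)) v := by
  have d1 := ((hasDerivAt_pow (k+1) v).const_mul (((k:ℝ)+2)*a)).const_sub 1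
  have d2 := d1.add ((hasDerivAt_pow (k+2) v).const_mul ((k:ℝ)+1))
  refine d2.congr_deriv ?_
  simp
  ring

lemma B_anti (k : ℕ) (a : ℝ) :
    AntitoneOn (fun v : ℝ => 1 - (k+2) * a * v^(k+1) + (k+1) * v^(k+2)) (Set.Icc 0 a) := by
  apply antitoneOn_of_deriv_nonpos (convex_Icc _ _)
  · fun_prop
  · fun_prop
  · rw [interior_Icc]
    intro v hv
    rw [(B_deriv k a v).deriv]
    have := hv.1
    apply mul_nonpos_of_nonneg_of_nonpos (by positivity) (by linarith [hv.2])

lemma B_mono (k : ℕ) (a : ℝ) (ha : 0 ≤ a) :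
    MonotoneOn (fun v : ℝ => 1 - (k+2) * a * v^(k+1) + (k+1) * v^(k+2)) (Set.Ici a) := by
  apply monotoneOn_of_deriv_nonneg (convex_Ici _)
  · fun_prop
  · fun_prop
  · rw [interior_Ici]
    intro v hv
    rw [(B_deriv k a v).deriv]
    have hv' : a < v := hv
    have : 0 < v := by linarith
    apply mul_nonneg (by positivity) (by linarith)

/-- Feasibility of `θ*` for every `n = k + 2`. -/
lemma feasible (θ : ℝ) (hθ : θ ∈ Set.Ioo (0:ℝ) 1) (H H' : ℝ → ℝ)
    (hmaps : ∀ x ∈ Set.Icc (0:ℝ) 1, H x ∈ Set.Icc (0:ℝ) 1)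
    (hcont : ContinuousOn H (Set.Icc (0:ℝ) 1))
    (hH0 : H 0 = 1) (hH1 : H 1 = 0)
    (hpos : ∀ x ∈ Set.Ioo (0:ℝ) 1, 0 < H x)
    (hderiv : ∀ x ∈ Set.Ioo (0:ℝ) 1, HasDerivAt H (H' x) x)
    (hode : ∀ x ∈ Set.Ioo (0:ℝ) 1, 1/θ - 1 = H x * (Real.log (H x) - 1) - H' x) (k : ℕ) :
    ∃ y : ℕ → ℝ,
    (∀ i ∈ Finset.Icc 1 (k+2), 0 ≤ y i) ∧
    (∑ i ∈ Finset.Icc 1 (k+2), y i ≤ 1) ∧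
    ∀ κ ∈ Set.Ioc (0:ℝ) 1,
      (1 - (1 - κ) ^ (k+2)) * θ ≤
        ∑ i ∈ Finset.Icc 1 (k+2),
          min (y i) (κ * (1 - ∑ i' ∈ Finset.Icc 1 (i-1), y i')) := by
  obtain ⟨hθ0, hθ1⟩ := hθ
  set c := 1/θ - 1 with hcdef
  have hc : 0 < c := by
    have : 1 < 1/θ := by rw [lt_div_iff₀ hθ0]; linarith
    linarith
  have hθc : θ * c = 1 - θ := by rw [hcdef]; field_simp
  let T : ℝ → ℝ := fun v => max (((k+1) * v^(k+2) - c)/(k+2)) 0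
  let v : ℕ → ℝ := fun i => Nat.rec 1 (fun _ v => (T v) ^ (((k+1 : ℕ) : ℝ)⁻¹)) i
  have v0 : v 0 = 1 := rfl
  have vs : ∀ i, v (i+1) = (T (v i)) ^ (((k+1 : ℕ) : ℝ)⁻¹) := fun i => rfl
  have hT0 : ∀ u, 0 ≤ T u := fun u => le_max_right _ _
  have vsp : ∀ i, v (i+1) ^ (k+1) = T (v i) := fun i => by
    rw [vs, Real.rpow_inv_natCast_pow (hT0 _) (by omega)]
  have vnn : ∀ i, 0 ≤ v i := by
    intro i
    cases i with
    | zero => rw [v0]; norm_num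
    | succ i => rw [vs]; exact Real.rpow_nonneg (hT0 _) _
  have hk2 : (0:ℝ) < k + 2 := by positivity
  have Tle : ∀ u, 0 ≤ u → u ≤ 1 → T u ≤ u^(k+1) := by
    intro u hu0 hu1
    apply max_le _ (by positivity)
    rw [div_le_iff₀ hk2]
    have : u^(k+2) ≤ u^(k+1) := pow_le_pow_of_le_one hu0 hu1 (by omega)
    have h0 : 0 ≤ u^(k+1) := by positivity
    have : ((k:ℝ)+1) * u^(k+2) ≤ (k+1) * u^(k+1) := by gcongr
    nlinarith
  have vle1 : ∀ i, v i ≤ 1 := by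
    intro i
    induction i with
    | zero => rw [v0]
    | succ i ih =>
      have h1 : v (i+1) ^ (k+1) ≤ v i ^ (k+1) := by rw [vsp]; exact Tle _ (vnn i) ih
      exact (le_of_pow_le_pow_left₀ (by omega) (vnn i) h1).trans ih
  have vanti : ∀ i, v (i+1) ≤ v i := fun i => by
    have h1 : v (i+1) ^ (k+1) ≤ v i ^ (k+1) := by rw [vsp]; exact Tle _ (vnn i) (vle1 i)
    exact le_of_pow_le_pow_left₀ (by omega) (vnn i) h1
  have vH : ∀ i, i ≤ k+2 → v i ^ (k+1) ≤ H (i / (k+2)) := by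
    intro i
    induction i with
    | zero => intro _; simp [v0, hH0]
    | succ i ih =>
      intro hi
      have ih := ih (by omega)
      have hile : (i:ℝ) + 1 ≤ k + 2 := by exact_mod_cast hi
      have hx1 : (i:ℝ)/(k+2) < 1 := by rw [div_lt_one hk2]; linarith
      have hx0 : 0 ≤ (i:ℝ)/(k+2) := by positivity
      have hHx : 0 < H (i/(k+2)) := by
        rcases hx0.eq_or_lt with h | h
        · rw [← h, hH0]; norm_num
        · exact hpos _ ⟨h, hx1⟩
      have hadd : (i:ℝ)/(k+2) + 1/(k+2) = ((i+1 : ℕ) : ℝ)/(k+2) := by push_cast; ring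
      have hle1 : ((i+1 : ℕ) : ℝ)/(k+2) ≤ 1 := by
        rw [div_le_one hk2]; push_cast; linarith
      rw [vsp]
      apply max_le
      · have hst := step c hc H H' hmaps hcont hpos hderiv hode (i/(k+2)) (1/(k+2)) hx0
          (by positivity) (by rw [div_lt_one hk2]; linarith [(Nat.cast_nonneg k : (0:ℝ) ≤ k)])
          (by rw [hadd]; exact hle1) hHx
        rw [hadd] at hst
        refine le_trans ?_ hst
        have hvp : v i ^ (k+2) ≤ Real.exp (Real.log (H (i/(k+2))) / (1 - 1/(k+2))) := by
          rcases (vnn i).eq_or_lt with h | h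
          · rw [← h]; simp; positivity
          · have e : v i ^ (k+2) = Real.exp ((k+2) * Real.log (v i)) := by
              rw [mul_comm, Real.exp_mul, Real.exp_log h]
              exact_mod_cast (Real.rpow_natCast (v i) (k+2)).symm
            rw [e]
            apply Real.exp_le_exp.mpr
            have hl : Real.log (v i ^ (k+1)) ≤ Real.log (H (i/(k+2))) :=
              Real.log_le_log (by positivity) ih
            rw [Real.log_pow] at hl
            push_cast at hl
            have e2 : (1 - 1/((k:ℝ)+2)) = (k+1)/(k+2) := by field_simp; ring
            rw [e2, le_div_iff₀ (by positivity)]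
            calc _ = (k+1) * Real.log (v i) := by field_simp
              _ ≤ _ := hl
        have e2 : (1 - 1/((k:ℝ)+2)) = (k+1)/(k+2) := by field_simp; ring
        rw [e2] at hvp ⊢
        calc _ = (k+1)/(k+2) * v i ^ (k+2) - 1/(k+2)*c := by ring
          _ ≤ _ := by gcongr
      · exact (hmaps _ ⟨by positivity, hle1⟩).1
  have vn : v (k+2) = 0 := by
    have h1 := vH (k+2) le_rfl
    have : (((k+2 : ℕ):ℝ)/(k+2)) = 1 := by push_cast; field_simp
    rw [this, hH1] at h1
    have h2 : v (k+2) ^ (k+1) = 0 := le_antisymm h1 (pow_nonneg (vnn (k+2)) (k+1))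
    exact pow_eq_zero_iff (by omega) |>.mp h2
  -- the remaining mass
  let R : ℕ → ℝ := fun i => 1 - θ * (1 - (k+2) * 1 * (v i)^(k+1) + (k+1) * (v i)^(k+2))
  have R0 : R 0 = 1 := by simp only [R, v0]; ring
  have ysum : ∀ j, ∑ i ∈ Finset.Icc 1 j, (R (i-1) - R i) = 1 - R j := by
    intro j
    rw [sum_Icc_one']
    simp only [Nat.add_sub_cancel]
    rw [Finset.sum_range_sub', R0]
  refine ⟨fun i => R (i-1) - R i, ?_, ?_, ?_⟩
  · intro i hi
    obtain ⟨j, rfl⟩ : ∃ j, i = j+1 := ⟨i-1, by have := (Finset.mem_Icc.mp hi).1; omega⟩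
    have := B_anti k 1 ⟨vnn (j+1), vle1 (j+1)⟩ ⟨vnn j, vle1 j⟩ (vanti j)
    simp only at this
    simp only [Nat.add_sub_cancel, R]
    nlinarith [mul_le_mul_of_nonneg_left this hθ0.le]
  · rw [ysum]
    simp only [R, vn]
    simp
    exact hθ1.le
  · intro κ hκ
    have hκ0 := hκ.1
    have hκ1 := hκ.2
    simp only [ysum]
    rw [sum_Icc_one']
    simp only [Nat.add_sub_cancel, sub_sub_cancel]
    set a := 1 - κ with ha
    have ha0 : 0 ≤ a := by linarith
    let B : ℝ → ℝ := fun v => 1 - (k+2) * a * v^(k+1) + (k+1) * v^(k+2)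
    let M : ℝ → ℝ := fun v => B (max v a) - (k+2) * κ * v^(k+1)
    have hterm : ∀ i, θ * M (v (i+1)) - θ * M (v i) ≤ min (R i - R (i+1)) (κ * R i) := by
      intro i
      have hle := vanti i
      have hn := vnn (i+1)
      apply le_min
      · have hanti : B (v i) - B (max (v i) a) ≤ B (v (i+1)) - B (max (v (i+1)) a) := by
          rcases le_total (v i) a with h | h
          · rw [max_eq_right h, max_eq_right (hle.trans h)]
            have : B (v i) ≤ B (v (i+1)) := B_anti k a ⟨hn, hle.trans h⟩ ⟨vnn i, h⟩ hle
            linarith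
          · rw [max_eq_left h]
            rcases le_total (v (i+1)) a with h' | h'
            · rw [max_eq_right h']
              have : B a ≤ B (v (i+1)) := B_anti k a ⟨hn, h'⟩ ⟨ha0, le_rfl⟩ h'
              linarith
            · rw [max_eq_left h']; linarith
        have e : R i - R (i+1) = θ * ((B (v (i+1)) - (k+2) * κ * (v (i+1))^(k+1))
            - (B (v i) - (k+2) * κ * (v i)^(k+1))) := by
          simp only [R, B, ha]; ring
        rw [e, ← mul_sub]
        apply mul_le_mul_of_nonneg_left _ hθ0.le
        simp only [M]
        linarith
      · have hmono : B (max (v (i+1)) a) ≤ B (max (v i) a) :=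
          B_mono k a ha0 (Set.mem_Ici.mpr (le_max_right _ _)) (Set.mem_Ici.mpr (le_max_right _ _))
            (max_le_max_right _ hle)
        have h1 : ((k+1) * (v i)^(k+2) - c)/(k+2) ≤ v (i+1)^(k+1) := by
          rw [vsp]; exact le_max_left _ _
        rw [div_le_iff₀ hk2] at h1
        have h2 : θ * ((k+2) * (v i^(k+1) - v (i+1)^(k+1))) ≤ R i := by
          have := mul_le_mul_of_nonneg_left h1 hθ0.le
          simp only [R]
          linarith
        have h3 := mul_le_mul_of_nonneg_left h2 hκ0.le
        have h4 := mul_le_mul_of_nonneg_left hmono hθ0.le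
        simp only [M]
        linarith
    refine le_trans ?_ (Finset.sum_le_sum (fun i _ => hterm i))
    rw [Finset.sum_range_sub (fun i => θ * M (v i)), vn, v0]
    simp only [M, B]
    rw [max_eq_right ha0, max_eq_left (by linarith : a ≤ 1)]
    apply le_of_eq
    simp
    rw [ha]
    ring

lemma ii_of_cont (f : ℝ → ℝ) (hf : ContinuousOn f (Set.Icc 0 1)) (a b : ℝ) (ha : 0 ≤ a)
    (hab : a ≤ b) (hb : b ≤ 1) : IntervalIntegrable f MeasureTheory.volume a b :=
  (hf.mono (Set.Icc_subset_Icc ha hb)).intervalIntegrable_of_Icc hab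

lemma first_order (n : ℕ) (θ S : ℝ)
    (h : ∀ κ ∈ Set.Ioc (0:ℝ) 1, (1 - (1 - κ) ^ n) * θ ≤ κ * S) : n * θ ≤ S := by
  have h1 : ∀ κ ∈ Set.Ioc (0:ℝ) 1, (∑ j ∈ Finset.range n, (1 - κ)^j) * θ ≤ S := by
    intro κ hκ
    have := h κ hκ
    have e : (∑ j ∈ Finset.range n, (1 - κ)^j) * κ = 1 - (1 - κ)^n := by
      have := geom_sum_mul_neg (1 - κ) n
      simpa using this
    rw [← e] at this
    have h2 : κ * ((∑ j ∈ Finset.range n, (1 - κ)^j) * θ) ≤ κ * S := by linarith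
    exact le_of_mul_le_mul_left h2 hκ.1
  have hc : Continuous (fun κ : ℝ => (∑ j ∈ Finset.range n, (1 - κ)^j) * θ) := by fun_prop
  have ht : Filter.Tendsto (fun κ : ℝ => (∑ j ∈ Finset.range n, (1 - κ)^j) * θ)
      (nhdsWithin 0 (Set.Ioi 0)) (nhds (n * θ)) := by
    have := (hc.tendsto 0).mono_left (nhdsWithin_le_nhds (s := Set.Ioi (0:ℝ)))
    simpa using this
  apply le_of_tendsto ht
  filter_upwards [Ioc_mem_nhdsGT (zero_lt_one : (0:ℝ) < 1)] with κ hκ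
  exact h1 κ hκ

/-- Upper bound by an explicit dual solution. -/
lemma upper (θ : ℝ) (hθ : θ ∈ Set.Ioo (0:ℝ) 1) (H H' : ℝ → ℝ)
    (hmaps : ∀ x ∈ Set.Icc (0:ℝ) 1, H x ∈ Set.Icc (0:ℝ) 1)
    (hcont : ContinuousOn H (Set.Icc (0:ℝ) 1))
    (hH0 : H 0 = 1) (hH1 : H 1 = 0)
    (hpos : ∀ x ∈ Set.Ioo (0:ℝ) 1, 0 < H x)
    (hderiv : ∀ x ∈ Set.Ioo (0:ℝ) 1, HasDerivAt H (H' x) x)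
    (hode : ∀ x ∈ Set.Ioo (0:ℝ) 1, 1/θ - 1 = H x * (Real.log (H x) - 1) - H' x)
    (n : ℕ) (hn : 0 < n) (t : ℝ) (y : ℕ → ℝ)
    (hy0 : ∀ i ∈ Finset.Icc 1 n, 0 ≤ y i)
    (hy1 : ∑ i ∈ Finset.Icc 1 n, y i ≤ 1)
    (hy : ∀ κ ∈ Set.Ioc (0:ℝ) 1,
      (1 - (1 - κ) ^ n) * t ≤
        ∑ i ∈ Finset.Icc 1 n, min (y i) (κ * (1 - ∑ i' ∈ Finset.Icc 1 (i-1), y i'))) :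
    t ≤ θ + (1/(1/θ-1)/θ) / n := by
  obtain ⟨hθ0, hθ1⟩ := hθ
  set c := 1/θ - 1 with hcdef
  have hc : 0 < c := by
    have : 1 < 1/θ := by rw [lt_div_iff₀ hθ0]; linarith
    linarith
  have hθc : θ * c = 1 - θ := by rw [hcdef]; field_simp
  have hn0 : (0:ℝ) < n := by exact_mod_cast hn
  -- remaining mass
  let R : ℕ → ℝ := fun i => 1 - ∑ i' ∈ Finset.Icc 1 i, y i'
  have R0 : R 0 = 1 := by simp [R]
  have Rs : ∀ i, R i - R (i+1) = y (i+1) := by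
    intro i
    simp only [R, sum_Icc_one', Finset.sum_range_succ]
    ring
  have yn : ∀ i, i < n → 0 ≤ y (i+1) := fun i hi => hy0 _ (Finset.mem_Icc.mpr ⟨by omega, by omega⟩)
  have Rle : ∀ i, i ≤ n → R i ≤ 1 := by
    intro i hi
    have : 0 ≤ ∑ i' ∈ Finset.Icc 1 i, y i' := Finset.sum_nonneg fun j hj =>
      hy0 j (Finset.Icc_subset_Icc_right hi hj)
    simp only [R]; linarith
  have Rnn : ∀ i, i ≤ n → 0 ≤ R i := by
    intro i hi
    have : ∑ i' ∈ Finset.Icc 1 i, y i' ≤ ∑ i' ∈ Finset.Icc 1 n, y i' :=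
      Finset.sum_le_sum_of_subset_of_nonneg (Finset.Icc_subset_Icc_right hi)
        fun j hj _ => hy0 j hj
    simp only [R]; linarith
  have hyR : ∀ κ ∈ Set.Ioc (0:ℝ) 1,
      (1 - (1 - κ) ^ n) * t ≤ ∑ i ∈ Finset.range n, min (y (i+1)) (κ * R i) := by
    intro κ hκ
    have := hy κ hκ
    rw [sum_Icc_one'] at this
    simpa only [Nat.add_sub_cancel] using this
  have hfo : n * t ≤ ∑ i ∈ Finset.range n, R i := by
    apply first_order
    intro κ hκ
    rw [Finset.mul_sum]
    exact (hyR κ hκ).trans (Finset.sum_le_sum fun i _ => min_le_right _ _)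
  -- dual weights
  let N : ℝ → ℝ := fun x => c + H x - H x * Real.log (H x)
  let m : ℝ → ℝ := fun x => (N x)⁻¹
  have Npos : ∀ x ∈ Set.Icc (0:ℝ) 1, 0 < N x := by
    intro x hx
    obtain ⟨h0, h1⟩ := hmaps x hx
    have := Real.log_nonpos h0 h1
    simp only [N]
    nlinarith [mul_nonneg h0 (neg_nonneg.mpr this)]
  have Ncont : ContinuousOn N (Set.Icc 0 1) :=
    (continuousOn_const.add hcont).sub (Real.continuous_mul_log.comp_continuousOn hcont)
  have mcont : ContinuousOn m (Set.Icc 0 1) := Ncont.inv₀ fun x hx => (Npos x hx).ne'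
  have mpos : ∀ x ∈ Set.Icc (0:ℝ) 1, 0 < m x := fun x hx => inv_pos.mpr (Npos x hx)
  have m0 : m 0 = θ := by
    simp only [m, N, hH0, hcdef]; simp
  have m1 : m 1 = 1/c := by simp [m, N, hH1]
  have hIoo : Set.Ioo (0:ℝ) 1 ⊆ Set.Icc 0 1 := Set.Ioo_subset_Icc_self
  have hH'N : ∀ x ∈ Set.Ioo (0:ℝ) 1, H' x = - N x := by
    intro x hx
    have := hode x hx
    simp only [N]; linarith
  have mder : ∀ x ∈ Set.Ioo (0:ℝ) 1, HasDerivAt m (m x * (-Real.log (H x))) x := by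
    intro x hx
    have hd := hderiv x hx
    have hHx := (hpos x hx)
    have hN := (Npos x (hIoo hx)).ne'
    have d1 : HasDerivAt N (H' x - (H' x * Real.log (H x) + H x * (H' x / H x))) x :=
      (hd.const_add c).sub (hd.mul (hd.log hHx.ne'))
    have d2 := d1.inv hN
    refine d2.congr_deriv ?_
    rw [hH'N x hx]
    simp only [m]
    field_simp
    ring
  have mmono : MonotoneOn m (Set.Icc 0 1) := by
    apply monotoneOn_of_deriv_nonneg (convex_Icc _ _) mcont
    · rw [interior_Icc]
      exact fun x hx => (mder x hx).differentiableAt.differentiableWithinAt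
    · rw [interior_Icc]
      intro x hx
      rw [(mder x hx).deriv]
      have h1 := hmaps x (hIoo hx)
      exact mul_nonneg (mpos x (hIoo hx)).le (neg_nonneg.mpr (Real.log_nonpos h1.1 h1.2))
  have mHcont : ContinuousOn (fun x => m x * H x) (Set.Icc 0 1) := mcont.mul hcont
  have hident : c * (∫ x in (0:ℝ)..1, m x) + ∫ x in (0:ℝ)..1, m x * H x = θ := by
    have h := intervalIntegral.integral_eq_sub_of_hasDerivAt_of_le (zero_le_one : (0:ℝ) ≤ 1)
      (f := fun x => -(m x * H x)) (f' := fun x => c * m x + m x * H x) mHcont.neg ?_ ?_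
    · rw [intervalIntegral.integral_add, intervalIntegral.integral_const_mul] at h
      · rw [h, hH0, hH1, m0]; ring
      · exact ii_of_cont _ (continuousOn_const.mul mcont) _ _ le_rfl zero_le_one le_rfl
      · exact ii_of_cont _ mHcont _ _ le_rfl zero_le_one le_rfl
    · intro x hx
      refine (((mder x hx).mul (hderiv x hx)).neg).congr_deriv ?_
      have hN := (Npos x (hIoo hx)).ne'
      rw [hH'N x hx]
      have e : m x * N x = 1 := inv_mul_cancel₀ hN
      have e2 : N x = c + H x - H x * Real.log (H x) := rfl
      rw [e2] at e ⊢
      linear_combination 0 * e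
    · exact ii_of_cont _ ((continuousOn_const.mul mcont).add mHcont) _ _ le_rfl zero_le_one le_rfl
  let V : ℝ → ℝ := fun z => ∫ x in z..1, m x
  -- quantiles
  let κ : ℝ → ℝ := fun x => 1 - (H x) ^ ((n:ℝ)⁻¹)
  have κcont : ContinuousOn κ (Set.Icc 0 1) :=
    continuousOn_const.sub (hcont.rpow_const fun x _ => Or.inr (by positivity))
  have κmem : ∀ x ∈ Set.Icc (0:ℝ) 1, κ x ∈ Set.Icc (0:ℝ) 1 := by
    intro x hx
    obtain ⟨h0, h1⟩ := hmaps x hx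
    have a1 := Real.rpow_nonneg h0 ((n:ℝ)⁻¹)
    have a2 := Real.rpow_le_one h0 h1 (by positivity : 0 ≤ (n:ℝ)⁻¹)
    exact ⟨by simp only [κ]; linarith, by simp only [κ]; linarith⟩
  have κpow : ∀ x ∈ Set.Icc (0:ℝ) 1, 1 - (1 - κ x)^n = 1 - H x := by
    intro x hx
    simp only [κ, sub_sub_cancel]
    rw [Real.rpow_inv_natCast_pow (hmaps x hx).1 hn.ne']
  have κlog : ∀ x ∈ Set.Ioo (0:ℝ) 1, κ x ≤ -Real.log (H x) / n := by
    intro x hx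
    simp only [κ]
    rw [Real.rpow_def_of_pos (hpos x hx)]
    have := Real.add_one_le_exp (Real.log (H x) * (n:ℝ)⁻¹)
    have e : -Real.log (H x) / n = -(Real.log (H x) * (n:ℝ)⁻¹) := by ring
    rw [e]; linarith
  have mκcont : ContinuousOn (fun x => m x * κ x) (Set.Icc 0 1) := mcont.mul κcont
  have hmκ : ∀ z ∈ Set.Icc (0:ℝ) 1, ∫ x in (0:ℝ)..z, m x * κ x ≤ (m z - θ) / n := by
    intro z hz
    have hsub : Set.Icc 0 z ⊆ Set.Icc (0:ℝ) 1 := Set.Icc_subset_Icc_right hz.2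
    have h := intervalIntegral.integral_le_sub_of_hasDeriv_right_of_le (a := 0) (b := z)
      (g := fun x => m x / n) (g' := fun x => m x * (-Real.log (H x)) / n)
      (φ := fun x => m x * κ x) hz.1 ((mcont.mono hsub).div_const _) ?_ ?_ ?_
    · refine h.trans (le_of_eq ?_)
      rw [m0]; ring
    · intro x hx
      exact ((mder x ⟨hx.1, hx.2.trans_le hz.2⟩).div_const _).hasDerivWithinAt
    · exact (mκcont.mono hsub).integrableOn_Icc
    · intro x hx
      have hx' : x ∈ Set.Ioo (0:ℝ) 1 := ⟨hx.1, hx.2.trans_le hz.2⟩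
      have := mul_le_mul_of_nonneg_left (κlog x hx') (mpos x (hIoo hx')).le
      rw [mul_div_assoc]
      exact this
  -- integrated constraint
  have gcont : ∀ i, ContinuousOn (fun x => m x * min (y (i+1)) (κ x * R i)) (Set.Icc 0 1) :=
    fun i => mcont.mul (continuousOn_const.inf (κcont.mul continuousOn_const))
  have hint : t * (V 0 - ∫ x in (0:ℝ)..1, m x * H x) ≤
      ∑ i ∈ Finset.range n, ∫ x in (0:ℝ)..1, m x * min (y (i+1)) (κ x * R i) := by
    rw [← intervalIntegral.integral_finsetSum
      (fun i _ => ii_of_cont _ (gcont i) _ _ le_rfl zero_le_one le_rfl)]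
    simp only [V]
    rw [← intervalIntegral.integral_sub (ii_of_cont _ mcont _ _ le_rfl zero_le_one le_rfl)
      (ii_of_cont _ mHcont _ _ le_rfl zero_le_one le_rfl), ← intervalIntegral.integral_const_mul]
    apply intervalIntegral.integral_mono_on zero_le_one
    · exact ii_of_cont _ (continuousOn_const.mul (mcont.sub mHcont)) _ _ le_rfl zero_le_one le_rfl
    · exact ii_of_cont _ (continuousOn_finsetSum _ fun i _ => gcont i) _ _ le_rfl zero_le_one le_rfl
    · intro x hx
      rw [← Finset.mul_sum]
      have e : t * (m x - m x * H x) = m x * ((1 - H x) * t) := by ring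
      rw [e]
      apply mul_le_mul_of_nonneg_left _ (mpos x hx).le
      rw [← κpow x hx]
      obtain ⟨k0, k1⟩ := κmem x hx
      rcases k0.eq_or_lt with h | h
      · rw [← h]
        simp only [sub_zero, one_pow, sub_self, zero_mul]
        apply Finset.sum_nonneg
        intro i hi
        exact le_min (yn i (Finset.mem_range.mp hi)) le_rfl
      · exact hyR _ ⟨h, k1⟩
  have hJ : ∀ i, i < n → ∀ z ∈ Set.Icc (0:ℝ) 1,
      ∫ x in (0:ℝ)..1, m x * min (y (i+1)) (κ x * R i) ≤ R i * ((m z - θ)/n) + y (i+1) * V z := by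
    intro i hi z hz
    rw [← intervalIntegral.integral_add_adjacent_intervals
      (ii_of_cont _ (gcont i) 0 z le_rfl hz.1 hz.2) (ii_of_cont _ (gcont i) z 1 hz.1 hz.2 le_rfl)]
    apply add_le_add
    · refine le_trans ?_ (mul_le_mul_of_nonneg_left (hmκ z hz) (Rnn i hi.le))
      rw [← intervalIntegral.integral_const_mul]
      apply intervalIntegral.integral_mono_on hz.1 (ii_of_cont _ (gcont i) 0 z le_rfl hz.1 hz.2)
        (ii_of_cont _ (continuousOn_const.mul mκcont) 0 z le_rfl hz.1 hz.2)
      intro x hx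
      have hx' : x ∈ Set.Icc (0:ℝ) 1 := ⟨hx.1, hx.2.trans hz.2⟩
      calc _ ≤ m x * (κ x * R i) := mul_le_mul_of_nonneg_left (min_le_right _ _) (mpos x hx').le
        _ = R i * (m x * κ x) := by ring
    · simp only [V]
      rw [← intervalIntegral.integral_const_mul]
      apply intervalIntegral.integral_mono_on hz.2 (ii_of_cont _ (gcont i) z 1 hz.1 hz.2 le_rfl)
        (ii_of_cont _ (continuousOn_const.mul mcont) z 1 hz.1 hz.2 le_rfl)
      intro x hx
      have hx' : x ∈ Set.Icc (0:ℝ) 1 := ⟨hz.1.trans hx.1, hx.2⟩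
      calc _ ≤ m x * y (i+1) := mul_le_mul_of_nonneg_left (min_le_left _ _) (mpos x hx').le
        _ = y (i+1) * m x := by ring
  have hV : ∀ a b : ℝ, 0 ≤ a → a ≤ b → b ≤ 1 → m a * (b - a) ≤ V a - V b := by
    intro a b ha hab hb
    have e : V a - V b = ∫ x in a..b, m x := by
      simp only [V]
      rw [← intervalIntegral.integral_add_adjacent_intervals (ii_of_cont _ mcont a b ha hab hb)
        (ii_of_cont _ mcont b 1 (ha.trans hab) hb le_rfl)]
      ring
    rw [e]
    have e2 : m a * (b - a) = ∫ x in a..b, m a := by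
      rw [intervalIntegral.integral_const]; simp [mul_comm]
    rw [e2]
    apply intervalIntegral.integral_mono_on hab (by simp) (ii_of_cont _ mcont a b ha hab hb)
    intro x hx
    exact mmono ⟨ha, hab.trans hb⟩ ⟨ha.trans hx.1, hx.2.trans hb⟩ hx.1
  have zmem : ∀ i : ℕ, i ≤ n → (i:ℝ)/n ∈ Set.Icc (0:ℝ) 1 := by
    intro i hi
    refine ⟨by positivity, ?_⟩
    rw [div_le_one hn0]; exact_mod_cast hi
  let Q : ℕ → ℝ := fun i => m (i/n) / n - R i * V (i/n)
  have hstep : ∀ i ∈ Finset.range n,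
      ∫ x in (0:ℝ)..1, m x * min (y (i+1)) (κ x * R i) ≤ Q (i+1) - Q i - θ / n * R i := by
    intro i hi
    have hi := Finset.mem_range.mp hi
    have h1 := hJ i hi _ (zmem (i+1) hi)
    have hle : (i:ℝ)/n ≤ ((i+1:ℕ):ℝ)/n := by gcongr; simp
    have h2 := hV _ _ (zmem i hi.le).1 hle (zmem (i+1) hi).2
    have e : ((i+1:ℕ):ℝ)/n - (i:ℝ)/n = 1/n := by push_cast; ring
    rw [e] at h2
    have h3 := mul_le_mul_of_nonneg_left h2 (Rnn i hi.le)
    have h4 := mmono (zmem i hi.le) (zmem (i+1) hi) hle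
    have h5 : R i * ((m (((i+1:ℕ):ℝ)/n) - m ((i:ℝ)/n)) / n)
        ≤ 1 * ((m (((i+1:ℕ):ℝ)/n) - m ((i:ℝ)/n)) / n) :=
      mul_le_mul_of_nonneg_right (Rle i hi.le) (div_nonneg (sub_nonneg.mpr h4) hn0.le)
    rw [← Rs i] at h1
    have h1' : ∫ x in (0:ℝ)..1, m x * min (y (i+1)) (κ x * R i) ≤
      R i * ((m (((i+1:ℕ):ℝ)/n) - θ)/n) + (R i - R (i+1)) * V (((i+1:ℕ):ℝ)/n) := by
      rw [← Rs i]; exact h1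
    simp only [Q]
    refine h1'.trans ?_
    have e1 : R i * ((m (((i+1:ℕ):ℝ)/n) - θ)/n) = R i * ((m (((i+1:ℕ):ℝ)/n) - m ((i:ℝ)/n)) / n)
      + R i * (m ((i:ℝ)/n) * (1/n)) - θ / n * R i := by ring
    have e2 : 1 * ((m (((i+1:ℕ):ℝ)/n) - m ((i:ℝ)/n)) / n)
      = m (((i+1:ℕ):ℝ)/n) / n - m ((i:ℝ)/n) / n := by ring
    rw [e1]
    linarith
  have hsum := hint.trans (Finset.sum_le_sum hstep)
  rw [Finset.sum_sub_distrib, Finset.sum_range_sub, ← Finset.mul_sum] at hsum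
  have hV1 : V 1 = 0 := by simp [V]
  have hQn : Q n = 1/c/n := by
    simp only [Q, div_self hn0.ne', hV1, m1]; ring
  have hQ0 : Q 0 = θ/n - V 0 := by
    simp only [Q, R0, Nat.cast_zero, zero_div, m0]; ring
  rw [hQn, hQ0] at hsum
  have hfo' : θ * t ≤ θ / n * ∑ i ∈ Finset.range n, R i := by
    have := mul_le_mul_of_nonneg_left hfo (by positivity : 0 ≤ θ / n)
    have e : θ / n * (n * t) = θ * t := by field_simp
    linarith
  set I := ∫ x in (0:ℝ)..1, m x * H x with hI
  have hV0 : V 0 = ∫ x in (0:ℝ)..1, m x := rfl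
  rw [← hV0] at hident
  have hid2 : V 0 = θ * (θ + (V 0 - I)) := by
    linear_combination θ * hident - V 0 * hθc
  have hVI : 0 ≤ V 0 - I := by
    rw [hV0, hI, ← intervalIntegral.integral_sub (ii_of_cont _ mcont _ _ le_rfl zero_le_one le_rfl)
      (ii_of_cont _ mHcont _ _ le_rfl zero_le_one le_rfl)]
    apply intervalIntegral.integral_nonneg zero_le_one
    intro x hx
    have := mul_le_mul_of_nonneg_left (hmaps x hx).2 (mpos x hx).le
    linarith
  have hfin : (t - θ) * (θ + (V 0 - I)) ≤ 1/c/n := by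
    have : 0 ≤ θ / n := by positivity
    nlinarith
  by_cases htθ : t ≤ θ
  · have : 0 ≤ 1/c/θ/n := by positivity
    linarith
  · push Not at htθ
    have h1 : (t - θ) * θ ≤ 1/c/n := by
      nlinarith [mul_nonneg (sub_nonneg.mpr htθ.le) hVI]
    have h2 : t - θ ≤ 1/c/n/θ := by rw [le_div_iff₀ hθ0]; exact h1
    have e : 1/c/n/θ = 1/c/θ/n := by ring
    linarith

/-- Theorem `limit`: if `θ* ∈ (0,1)` and `H : [0,1] → [0,1]` is continuous
with `H(0) = 1`, `H(1) = 0`, `H > 0` on `(0,1)`, differentiable on `(0,1)` with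
`1/θ* - 1 = H(x)(ln H(x) - 1) - H'(x)` there, then
`inf_{n≥2} iidLP^{DP/Proph}_{1,n} = lim_{n→∞} iidLP^{DP/Proph}_{1,n} = θ*`. -/
theorem stmt19 (θstar : ℝ) (hθ : θstar ∈ Set.Ioo (0:ℝ) 1)
    (H H' : ℝ → ℝ)
    (hmaps : ∀ x ∈ Set.Icc (0:ℝ) 1, H x ∈ Set.Icc (0:ℝ) 1)
    (hcont : ContinuousOn H (Set.Icc (0:ℝ) 1))
    (hH0 : H 0 = 1) (hH1 : H 1 = 0)
    (hpos : ∀ x ∈ Set.Ioo (0:ℝ) 1, 0 < H x)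
    (hderiv : ∀ x ∈ Set.Ioo (0:ℝ) 1, HasDerivAt H (H' x) x)
    (hode : ∀ x ∈ Set.Ioo (0:ℝ) 1, 1/θstar - 1 = H x * (Real.log (H x) - 1) - H' x) :
    sInf {v : ℝ | ∃ n : ℕ, 2 ≤ n ∧ v = iidLP1 n} = θstar ∧
    Filter.Tendsto (fun n : ℕ => iidLP1 n) Filter.atTop (nhds θstar) := by

  have hset : ∀ n : ℕ, 2 ≤ n → θstar ≤ iidLP1 n ∧
      iidLP1 n ≤ θstar + (1/(1/θstar-1)/θstar) / n := by
    intro n hn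
    obtain ⟨k, rfl⟩ : ∃ k, n = k + 2 := ⟨n - 2, by omega⟩
    have hf := feasible θstar hθ H H' hmaps hcont hH0 hH1 hpos hderiv hode k
    have hub : ∀ t ∈ {θ : ℝ | ∃ y : ℕ → ℝ,
        (∀ i ∈ Finset.Icc 1 (k+2), 0 ≤ y i) ∧
        (∑ i ∈ Finset.Icc 1 (k+2), y i ≤ 1) ∧
        ∀ κ ∈ Set.Ioc (0:ℝ) 1,
          (1 - (1 - κ) ^ (k+2)) * θ ≤
            ∑ i ∈ Finset.Icc 1 (k+2), min (y i) (κ * (1 - ∑ i' ∈ Finset.Icc 1 (i-1), y i'))},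
        t ≤ θstar + (1/(1/θstar-1)/θstar) / ((k+2 : ℕ) : ℝ) := by
      rintro t ⟨y, h0, h1, h2⟩
      exact upper θstar hθ H H' hmaps hcont hH0 hH1 hpos hderiv hode (k+2) (by omega) t y h0 h1 h2
    exact ⟨le_csSup ⟨_, hub⟩ hf, csSup_le ⟨_, hf⟩ hub⟩
  have hlim : Filter.Tendsto (fun n : ℕ => iidLP1 n) Filter.atTop (nhds θstar) := by
    have hT : Filter.Tendsto (fun n : ℕ => θstar + (1/(1/θstar-1)/θstar) / (n:ℝ))
        Filter.atTop (nhds θstar) := by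
      have := (tendsto_const_div_atTop_nhds_zero_nat (1/(1/θstar-1)/θstar)).const_add θstar
      simpa only [add_zero] using this
    refine tendsto_of_tendsto_of_tendsto_of_le_of_le' tendsto_const_nhds hT ?_ ?_
    · filter_upwards [Filter.eventually_ge_atTop 2] with n hn using (hset n hn).1
    · filter_upwards [Filter.eventually_ge_atTop 2] with n hn using (hset n hn).2
  refine ⟨le_antisymm ?_ ?_, hlim⟩
  · apply ge_of_tendsto hlim
    filter_upwards [Filter.eventually_ge_atTop 2] with n hn
    apply csInf_le
    · refine ⟨θstar, ?_⟩
      rintro v ⟨k, hk, rfl⟩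
      exact (hset k hk).1
    · exact ⟨n, hn, rfl⟩
  · refine le_csInf ⟨iidLP1 2, 2, le_rfl, rfl⟩ ?_
    rintro v ⟨k, hk, rfl⟩
    exact (hset k hk).1
end
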